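/- arXiv:2605.01442 — 3 statements merged into one kernel-verified Lean document; each statement's English description precedes it below -/
import Mathlib

section
/- Let T be an EL TBox (a finite set of EL GCIs), A and B EL concepts, and x an individual name. If J ⊆ T is a justification for A ⊑ B in T and J ⊭ ⊤ ⊑ B, then J ∪ {A(x)} is a justification for B(x) in T ∪ {A(x)}; in particular, a justification for A ⊑ B in T of cardinality n yields a justification for B(x) in T ∪ {A(x)} of cardinality n + 1. -/
/-- EL concepts over concept names `NC` and role names `NR`. -/
inductive ELConcept (NC NR : Type) : Type
  | atom  : NC → ELConcept NC NR
  | top   : ELConcept NC NR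
  | inter : ELConcept NC NR → ELConcept NC NR → ELConcept NC NR
  | ex    : NR → ELConcept NC NR → ELConcept NC NR

/-- EL axioms: GCIs, concept assertions, role assertions. -/
inductive ELAxiom (NC NR NI : Type) : Type
  | gci  : ELConcept NC NR → ELConcept NC NR → ELAxiom NC NR NI
  | inst : ELConcept NC NR → NI → ELAxiom NC NR NI
  | role : NR → NI → NI → ELAxiom NC NR NI

/-- A DL interpretation. -/
structure DLInterp (NC NR NI : Type) : Type 1 where
  Dom : Type
  dom_nonempty : Nonempty Dom
  cI : NC → Set Dom
  rI : NR → Set (Dom × Dom)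
  iI : NI → Dom

/-- Semantics of EL concepts. -/
def ELConcept.interp {NC NR NI : Type} (I : DLInterp NC NR NI) :
    ELConcept NC NR → Set I.Dom
  | .atom A => I.cI A
  | .top => Set.univ
  | .inter C D => C.interp I ∩ D.interp I
  | .ex r C => {d | ∃ e, (d, e) ∈ I.rI r ∧ e ∈ C.interp I}

/-- Satisfaction of an EL axiom in an interpretation. -/
def ELAxiom.sat {NC NR NI : Type} (I : DLInterp NC NR NI) :
    ELAxiom NC NR NI → Prop
  | .gci C D => C.interp I ⊆ D.interp I
  | .inst C a => I.iI a ∈ C.interp I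
  | .role r a b => (I.iI a, I.iI b) ∈ I.rI r

/-- `I` is a model of the set `S` of axioms. -/
def ELModels {NC NR NI : Type} (I : DLInterp NC NR NI) (S : Set (ELAxiom NC NR NI)) : Prop :=
  ∀ α ∈ S, α.sat I

/-- `S ⊨ α`. -/
def ELEntails {NC NR NI : Type} (S : Set (ELAxiom NC NR NI)) (α : ELAxiom NC NR NI) : Prop :=
  ∀ I : DLInterp NC NR NI, ELModels I S → α.sat I

/-- `S` is consistent. -/
def ELConsistent {NC NR NI : Type} (S : Set (ELAxiom NC NR NI)) : Prop :=
  ∃ I : DLInterp NC NR NI, ELModels I S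

/-- ABox assertions. -/
def ELAxiom.isAssertion {NC NR NI : Type} : ELAxiom NC NR NI → Prop
  | .gci _ _ => False
  | .inst _ _ => True
  | .role _ _ _ => True

/-- GCIs. -/
def ELAxiom.isGCI {NC NR NI : Type} : ELAxiom NC NR NI → Prop
  | .gci _ _ => True
  | .inst _ _ => False
  | .role _ _ _ => False

/-- `J` is a justification for `α` in `K`. -/
def ELJustification {NC NR NI : Type} (K : Set (ELAxiom NC NR NI))
    (α : ELAxiom NC NR NI) (J : Set (ELAxiom NC NR NI)) : Prop :=
  J ⊆ K ∧ ELEntails J α ∧ ∀ J' ⊂ J, ¬ ELEntails J' α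

/-- Reinterpret every individual name of `I` as the element `d`. -/
def DLInterp.withIndividual {NC NR NI : Type} (I : DLInterp NC NR NI) (d : I.Dom) :
    DLInterp NC NR NI :=
  { I with iI := fun _ => d }

theorem ELConcept.interp_withIndividual {NC NR NI : Type} (I : DLInterp NC NR NI) (d : I.Dom)
    (C : ELConcept NC NR) : C.interp (I.withIndividual d) = (C.interp I : Set I.Dom) := by
  induction C with
  | atom A => rfl
  | top => rfl
  | inter C D hC hD =>
    exact congrArg₂ (fun s t : Set I.Dom => s ∩ t) hC hD
  | ex r C hC =>
    exact congrArg (fun s : Set I.Dom => {d | ∃ e, (d, e) ∈ I.rI r ∧ e ∈ s}) hC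

theorem ELAxiom.sat_withIndividual {NC NR NI : Type} {α : ELAxiom NC NR NI}
    (hα : α.isGCI) {I : DLInterp NC NR NI} (d : I.Dom) (h : α.sat I) :
    α.sat (I.withIndividual d) := by
  cases α with
  | gci C D =>
    change C.interp (I.withIndividual d) ⊆ D.interp (I.withIndividual d)
    rw [ELConcept.interp_withIndividual, ELConcept.interp_withIndividual]
    exact h
  | inst C a => exact hα.elim
  | role r a b => exact hα.elim

theorem ELEntails.mono {NC NR NI : Type} {S S' : Set (ELAxiom NC NR NI)} {α : ELAxiom NC NR NI}
    (h : ELEntails S α) (hS : S ⊆ S') : ELEntails S' α :=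
  fun I hI => h I fun β hβ => hI β (hS hβ)

/-- Over a set of GCIs, subsumption reduces to instance checking. -/
theorem elEntails_union_inst_iff {NC NR NI : Type} {S : Set (ELAxiom NC NR NI)}
    (hS : ∀ α ∈ S, α.isGCI) (A B : ELConcept NC NR) (x : NI) :
    ELEntails (S ∪ {ELAxiom.inst A x}) (ELAxiom.inst B x) ↔
      ELEntails S (ELAxiom.gci A B) := by
  constructor
  · intro h I hI d hd
    have hB : d ∈ B.interp (I.withIndividual d) := by
      refine h (I.withIndividual d) ?_
      rintro β (hβ | rfl)
      · exact ELAxiom.sat_withIndividual (hS β hβ) d (hI β hβ)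
      · change d ∈ A.interp (I.withIndividual d)
        rw [ELConcept.interp_withIndividual]
        exact hd
    rw [ELConcept.interp_withIndividual] at hB
    exact hB
  · intro h I hI
    exact h I (fun β hβ => hI β (Or.inl hβ)) (hI _ (Or.inr rfl))

/-- if `J` is a justification for `A ⊑ B` in the EL TBox `T` and
`J ⊭ ⊤ ⊑ B`, then `J ∪ {A(x)}` is a justification for `B(x)` in `T ∪ {A(x)}`; in
particular, if `J` has cardinality `n`, then `J ∪ {A(x)}` has cardinality `n + 1`. -/
theorem justification_lifts_to_assertion {NC NR NI : Type}
    (T : Finset (ELAxiom NC NR NI)) (hT : ∀ α ∈ T, α.isGCI)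
    (A B : ELConcept NC NR) (x : NI)
    (J : Set (ELAxiom NC NR NI))
    (hJ : ELJustification (T : Set (ELAxiom NC NR NI)) (ELAxiom.gci A B) J)
    (hTop : ¬ ELEntails J (ELAxiom.gci ELConcept.top B)) :
    ELJustification ((T : Set (ELAxiom NC NR NI)) ∪ {ELAxiom.inst A x})
      (ELAxiom.inst B x) (J ∪ {ELAxiom.inst A x}) ∧
    ∀ n : ℕ, J.ncard = n → (J ∪ {ELAxiom.inst A x}).ncard = n + 1 := by
  obtain ⟨hJT, hent, hmin⟩ := hJ
  have hG : ∀ α ∈ J, α.isGCI := fun α hα => hT α (hJT hα)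
  have hx : ELAxiom.inst A x ∉ J := fun h => hG _ h
  refine ⟨⟨Set.union_subset_union_left _ hJT, (elEntails_union_inst_iff hG A B x).2 hent, ?_⟩, ?_⟩
  · intro J' hJ' hB
    by_cases hA : ELAxiom.inst A x ∈ J'
    · have hsub : J' \ {ELAxiom.inst A x} ⊆ J := fun β hβ => (hJ'.1 hβ.1).resolve_right hβ.2
      have hunion : (J' \ {ELAxiom.inst A x}) ∪ {ELAxiom.inst A x} = J' :=
        Set.sdiff_union_of_subset (Set.singleton_subset_iff.2 hA)
      refine hmin (J' \ {ELAxiom.inst A x}) (hsub.ssubset_of_ne ?_) ?_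
      · intro heq
        rw [heq] at hunion
        exact hJ'.ne hunion.symm
      · refine (elEntails_union_inst_iff (fun α hα => hG α (hsub hα)) A B x).1 ?_
        rwa [hunion]
    · have hsub : J' ⊆ J := fun β hβ =>
        (hJ'.1 hβ).resolve_right fun h => hA (Set.mem_singleton_iff.1 h ▸ hβ)
      exact hTop ((elEntails_union_inst_iff hG ELConcept.top B x).1
        (hB.mono (hsub.trans Set.subset_union_left)))
  · rintro n rfl
    rw [Set.union_singleton]
    exact Set.ncard_insert_of_notMem hx (T.finite_toSet.subset hJT)
end

section
/- (core of Theorems 3 and 5) Let K be an ALC knowledge base, C an ALC concept, and x, y individual names. If J is a justification for C(x) in K and y occurs in no axiom of J, then J[x↦y] — which equals J_T ∪ J_A[x↦y], where J_T and J_A are the sets of GCIs and of ABox assertions of J, respectively — is a subset-minimal set of axioms entailing C(y) (i.e., J[x↦y] ⊨ C(y) and no proper subset of J[x↦y] entails C(y)), and |J[x↦y]| = |J|. -/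
/-- ALC concepts over concept names `NC` and role names `NR`. -/
inductive ALCConcept (NC NR : Type) : Type
  | atom : NC → ALCConcept NC NR
  | top  : ALCConcept NC NR
  | bot  : ALCConcept NC NR
  | neg  : ALCConcept NC NR → ALCConcept NC NR
  | conj : ALCConcept NC NR → ALCConcept NC NR → ALCConcept NC NR
  | disj : ALCConcept NC NR → ALCConcept NC NR → ALCConcept NC NR
  | ex   : NR → ALCConcept NC NR → ALCConcept NC NR
  | all  : NR → ALCConcept NC NR → ALCConcept NC NR

/-- ALC axioms: GCIs, concept assertions, role assertions. -/
inductive ALCAxiom (NC NR NI : Type) : Type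
  | gci  : ALCConcept NC NR → ALCConcept NC NR → ALCAxiom NC NR NI
  | inst : ALCConcept NC NR → NI → ALCAxiom NC NR NI
  | role : NR → NI → NI → ALCAxiom NC NR NI

/-- Semantics of ALC concepts. -/
def ALCConcept.interp {NC NR NI : Type} (I : DLInterp NC NR NI) :
    ALCConcept NC NR → Set I.Dom
  | .atom A => I.cI A
  | .top => Set.univ
  | .bot => ∅
  | .neg C => (C.interp I)ᶜ
  | .conj C D => C.interp I ∩ D.interp I
  | .disj C D => C.interp I ∪ D.interp I
  | .ex r C => {d | ∃ e, (d, e) ∈ I.rI r ∧ e ∈ C.interp I}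
  | .all r C => {d | ∀ e, (d, e) ∈ I.rI r → e ∈ C.interp I}

/-- Satisfaction of an ALC axiom in an interpretation. -/
def ALCAxiom.sat {NC NR NI : Type} (I : DLInterp NC NR NI) :
    ALCAxiom NC NR NI → Prop
  | .gci C D => C.interp I ⊆ D.interp I
  | .inst C a => I.iI a ∈ C.interp I
  | .role r a b => (I.iI a, I.iI b) ∈ I.rI r

/-- `I` is a model of the set `S` of axioms. -/
def ALCModels {NC NR NI : Type} (I : DLInterp NC NR NI) (S : Set (ALCAxiom NC NR NI)) : Prop :=
  ∀ α ∈ S, α.sat I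

/-- `S ⊨ α`. -/
def ALCEntails {NC NR NI : Type} (S : Set (ALCAxiom NC NR NI)) (α : ALCAxiom NC NR NI) : Prop :=
  ∀ I : DLInterp NC NR NI, ALCModels I S → α.sat I

/-- `S` is consistent. -/
def ALCConsistent {NC NR NI : Type} (S : Set (ALCAxiom NC NR NI)) : Prop :=
  ∃ I : DLInterp NC NR NI, ALCModels I S

/-- ABox assertions. -/
def ALCAxiom.isAssertion {NC NR NI : Type} : ALCAxiom NC NR NI → Prop
  | .gci _ _ => False
  | .inst _ _ => True
  | .role _ _ _ => True

/-- GCIs. -/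
def ALCAxiom.isGCI {NC NR NI : Type} : ALCAxiom NC NR NI → Prop
  | .gci _ _ => True
  | .inst _ _ => False
  | .role _ _ _ => False

/-- `J` is a justification for `α` in `K`. -/
def ALCJustification {NC NR NI : Type} (K : Set (ALCAxiom NC NR NI))
    (α : ALCAxiom NC NR NI) (J : Set (ALCAxiom NC NR NI)) : Prop :=
  J ⊆ K ∧ ALCEntails J α ∧ ∀ J' ⊂ J, ¬ ALCEntails J' α

/-- Rename an individual name: replace `x` by `y`. -/
def renameInd {NI : Type} [DecidableEq NI] (x y a : NI) : NI := if a = x then y else a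

/-- `β[x↦y]`: replace every occurrence of the individual name `x` by `y`
(GCIs contain no individual names and are unchanged). -/
def ALCAxiom.rename {NC NR NI : Type} [DecidableEq NI] (x y : NI) :
    ALCAxiom NC NR NI → ALCAxiom NC NR NI
  | .gci C D => .gci C D
  | .inst C a => .inst C (renameInd x y a)
  | .role r a b => .role r (renameInd x y a) (renameInd x y b)

/-- The individual name `z` occurs in an ALC axiom. -/
def ALCAxiom.indOccurs {NC NR NI : Type} (z : NI) : ALCAxiom NC NR NI → Prop
  | .gci _ _ => False
  | .inst _ a => a = z
  | .role _ a b => a = z ∨ b = z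

/-- Precompose the interpretation of individual names with `f`. -/
def DLInterp.comapInd {NC NR NI : Type} (I : DLInterp NC NR NI) (f : NI → NI) :
    DLInterp NC NR NI :=
  { I with iI := I.iI ∘ f }

theorem ALCConcept.interp_comapInd {NC NR NI : Type} (I : DLInterp NC NR NI) (f : NI → NI)
    (C : ALCConcept NC NR) : C.interp (I.comapInd f) = C.interp I := by
  induction C with
  | atom A => rfl
  | top => rfl
  | bot => rfl
  | neg C ih => exact congrArg (fun s : Set I.Dom => sᶜ) ih
  | conj C D ihC ihD => exact congrArg₂ (fun s t : Set I.Dom => s ∩ t) ihC ihD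
  | disj C D ihC ihD => exact congrArg₂ (fun s t : Set I.Dom => s ∪ t) ihC ihD
  | ex r C ih =>
    exact congrArg (fun s : Set I.Dom => {d | ∃ e, (d, e) ∈ I.rI r ∧ e ∈ s}) ih
  | all r C ih =>
    exact congrArg (fun s : Set I.Dom => {d | ∀ e, (d, e) ∈ I.rI r → e ∈ s}) ih

theorem ALCAxiom.sat_rename {NC NR NI : Type} [DecidableEq NI] (I : DLInterp NC NR NI)
    (x y : NI) (β : ALCAxiom NC NR NI) :
    (β.rename x y).sat I ↔ β.sat (I.comapInd (renameInd x y)) := by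
  cases β with
  | gci C D =>
    simp only [ALCAxiom.rename, ALCAxiom.sat, ALCConcept.interp_comapInd]
    rfl
  | inst C a =>
    simp only [ALCAxiom.rename, ALCAxiom.sat, ALCConcept.interp_comapInd]
    rfl
  | role r a b => rfl

theorem ALCEntails.rename {NC NR NI : Type} [DecidableEq NI] {S : Set (ALCAxiom NC NR NI)}
    {α : ALCAxiom NC NR NI} (h : ALCEntails S α) (x y : NI) :
    ALCEntails (ALCAxiom.rename x y '' S) (α.rename x y) := fun I hI =>
  (α.sat_rename I x y).2 <| h _ fun β hβ =>
    (β.sat_rename I x y).1 <| hI _ <| Set.mem_image_of_mem _ hβ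

theorem renameInd_renameInd {NI : Type} [DecidableEq NI] {x y a : NI} (h : a ≠ y) :
    renameInd y x (renameInd x y a) = a := by
  unfold renameInd
  split_ifs <;> simp_all

theorem ALCAxiom.rename_rename {NC NR NI : Type} [DecidableEq NI] {x y : NI}
    {β : ALCAxiom NC NR NI} (h : ¬ β.indOccurs y) : (β.rename x y).rename y x = β := by
  cases β with
  | gci C D => rfl
  | inst C a => simp only [ALCAxiom.rename, renameInd_renameInd h]
  | role r a b =>
    obtain ⟨ha, hb⟩ := not_or.1 h
    simp only [ALCAxiom.rename, renameInd_renameInd ha, renameInd_renameInd hb]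

theorem ALCAxiom.image_rename {NC NR NI : Type} [DecidableEq NI] (x y : NI)
    (J : Set (ALCAxiom NC NR NI)) :
    ALCAxiom.rename x y '' J =
      {β ∈ J | β.isGCI} ∪ ALCAxiom.rename x y '' {β ∈ J | β.isAssertion} := by
  have hsplit : J = {β ∈ J | β.isGCI} ∪ {β ∈ J | β.isAssertion} := by
    ext β
    cases β <;> simp [ALCAxiom.isGCI, ALCAxiom.isAssertion]
  have hgci : ALCAxiom.rename x y '' {β ∈ J | β.isGCI} = {β ∈ J | β.isGCI} := by
    have hfix : Set.EqOn (ALCAxiom.rename x y) id {β ∈ J | β.isGCI} := by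
      rintro (_ | _ | _) ⟨_, hβ⟩
      · rfl
      · exact hβ.elim
      · exact hβ.elim
    rw [hfix.image_eq, Set.image_id]
  conv_lhs => rw [hsplit, Set.image_union, hgci]

/-- core of Theorems 3 and 5: if `J` is a justification for `C(x)` in `K`
and `y` occurs in no axiom of `J`, then `J[x↦y]` — which equals `J_T ∪ J_A[x↦y]`, where
`J_T` and `J_A` are the GCIs and the ABox assertions of `J` — is a subset-minimal set of
axioms entailing `C(y)`, and `|J[x↦y]| = |J|`. -/
theorem rename_of_justification {NC NR NI : Type} [DecidableEq NI]
    (K : Finset (ALCAxiom NC NR NI)) (C : ALCConcept NC NR) (x y : NI)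
    (J : Set (ALCAxiom NC NR NI))
    (hJ : ALCJustification (K : Set (ALCAxiom NC NR NI)) (ALCAxiom.inst C x) J)
    (hfresh : ∀ β ∈ J, ¬ ALCAxiom.indOccurs y β) :
    ALCAxiom.rename x y '' J =
      {β ∈ J | β.isGCI} ∪ ALCAxiom.rename x y '' {β ∈ J | β.isAssertion} ∧
    ALCEntails (ALCAxiom.rename x y '' J) (ALCAxiom.inst C y) ∧
    (∀ S ⊂ ALCAxiom.rename x y '' J, ¬ ALCEntails S (ALCAxiom.inst C y)) ∧
    (ALCAxiom.rename x y '' J).ncard = J.ncard := by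
  have hinv : Set.LeftInvOn (ALCAxiom.rename y x) (ALCAxiom.rename x y) J :=
    fun β hβ => ALCAxiom.rename_rename (hfresh β hβ)
  obtain ⟨-, hent, hmin⟩ := hJ
  refine ⟨ALCAxiom.image_rename x y J, ?_, ?_, hinv.injOn.ncard_image⟩
  · simpa [ALCAxiom.rename, renameInd] using hent.rename x y
  · intro S hS hSent
    obtain ⟨J', hJ', rfl⟩ := Set.subset_image_iff.1 hS.subset
    have hss : J' ⊂ J := hJ'.ssubset_of_ne fun h => hS.ne (h ▸ rfl)
    have hback := hSent.rename y x
    rw [(hinv.mono hJ').image_image] at hback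
    exact hmin J' hss (by simpa [ALCAxiom.rename, renameInd] using hback)
end

section
/- For n ≥ 1, let T_n := {A_{i-1} ⊑ X_i ⊓ Y_i, X_i ⊑ A_i, Y_i ⊑ A_i : 1 ≤ i ≤ n} be the EL TBox over pairwise distinct concept names A_0, …, A_n, X_1, …, X_n, Y_1, …, Y_n, and let K_n := T_n ∪ {A_0(x)} for an individual name x. Then K_n ⊨ A_n(x), and for every function f : {1, …, n} → {X, Y}, the set J_f := {A_0(x)} ∪ {A_{i-1} ⊑ X_i ⊓ Y_i : 1 ≤ i ≤ n} ∪ {f(i)_i ⊑ A_i : 1 ≤ i ≤ n} (where f(i)_i denotes X_i if f(i) = X and Y_i if f(i) = Y) is a justification for A_n(x) in K_n of cardinality 2n + 1. -/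
/-- The GCI `A_{i-1} ⊑ X_i ⊓ Y_i` (indices: `nm ∘ Sum.inl` lists `A_0, …, A_n`,
`nm ∘ Sum.inr ∘ Sum.inl` lists `X_1, …, X_n`, `nm ∘ Sum.inr ∘ Sum.inr` lists `Y_1, …, Y_n`). -/
def axGA (NC NR NI : Type) (n : ℕ) (nm : Fin (n + 1) ⊕ (Fin n ⊕ Fin n) → NC) (i : Fin n) :
    ELAxiom NC NR NI :=
  ELAxiom.gci (ELConcept.atom (nm (Sum.inl i.castSucc)))
    (ELConcept.inter (ELConcept.atom (nm (Sum.inr (Sum.inl i))))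
      (ELConcept.atom (nm (Sum.inr (Sum.inr i)))))

/-- The GCI `X_i ⊑ A_i`. -/
def axGX (NC NR NI : Type) (n : ℕ) (nm : Fin (n + 1) ⊕ (Fin n ⊕ Fin n) → NC) (i : Fin n) :
    ELAxiom NC NR NI :=
  ELAxiom.gci (ELConcept.atom (nm (Sum.inr (Sum.inl i))))
    (ELConcept.atom (nm (Sum.inl i.succ)))

/-- The GCI `Y_i ⊑ A_i`. -/
def axGY (NC NR NI : Type) (n : ℕ) (nm : Fin (n + 1) ⊕ (Fin n ⊕ Fin n) → NC) (i : Fin n) :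
    ELAxiom NC NR NI :=
  ELAxiom.gci (ELConcept.atom (nm (Sum.inr (Sum.inr i))))
    (ELConcept.atom (nm (Sum.inl i.succ)))

/-- The TBox `T_n = {A_{i-1} ⊑ X_i ⊓ Y_i, X_i ⊑ A_i, Y_i ⊑ A_i : 1 ≤ i ≤ n}`. -/
def TBn (NC NR NI : Type) (n : ℕ) (nm : Fin (n + 1) ⊕ (Fin n ⊕ Fin n) → NC) :
    Set (ELAxiom NC NR NI) :=
  Set.range (axGA NC NR NI n nm) ∪ Set.range (axGX NC NR NI n nm) ∪
    Set.range (axGY NC NR NI n nm)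

/-- The KB `K_n = T_n ∪ {A_0(x)}`. -/
def KBn (NC NR NI : Type) (n : ℕ) (nm : Fin (n + 1) ⊕ (Fin n ⊕ Fin n) → NC) (x : NI) :
    Set (ELAxiom NC NR NI) :=
  TBn NC NR NI n nm ∪ {ELAxiom.inst (ELConcept.atom (nm (Sum.inl 0))) x}

/-- The set `J_f = {A_0(x)} ∪ {A_{i-1} ⊑ X_i ⊓ Y_i : i} ∪ {f(i)_i ⊑ A_i : i}`,
where `f i = true` selects `X_i ⊑ A_i` and `f i = false` selects `Y_i ⊑ A_i`. -/
def Jfam (NC NR NI : Type) (n : ℕ) (nm : Fin (n + 1) ⊕ (Fin n ⊕ Fin n) → NC) (x : NI)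
    (f : Fin n → Bool) : Set (ELAxiom NC NR NI) :=
  {ELAxiom.inst (ELConcept.atom (nm (Sum.inl 0))) x} ∪
    Set.range (axGA NC NR NI n nm) ∪
    Set.range (fun i => if f i then axGX NC NR NI n nm i else axGY NC NR NI n nm i)

/-- The axioms of `J_f`, indexed: `none` is `A_0(x)`, `some (Sum.inl i)` is `A_{i-1} ⊑ X_i ⊓ Y_i`
and `some (Sum.inr i)` is `f(i)_i ⊑ A_i`. -/
def jfamAxiom (NC NR NI : Type) (n : ℕ) (nm : Fin (n + 1) ⊕ (Fin n ⊕ Fin n) → NC) (x : NI)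
    (f : Fin n → Bool) : Option (Fin n ⊕ Fin n) → ELAxiom NC NR NI
  | none => ELAxiom.inst (ELConcept.atom (nm (Sum.inl 0))) x
  | some (Sum.inl i) => axGA NC NR NI n nm i
  | some (Sum.inr i) => if f i then axGX NC NR NI n nm i else axGY NC NR NI n nm i

theorem range_jfamAxiom (NC NR NI : Type) (n : ℕ) (nm : Fin (n + 1) ⊕ (Fin n ⊕ Fin n) → NC)
    (x : NI) (f : Fin n → Bool) :
    Set.range (jfamAxiom NC NR NI n nm x f) = Jfam NC NR NI n nm x f := by
  ext α
  simp only [Set.mem_range, Option.exists, Sum.exists, jfamAxiom, Jfam, Set.mem_union,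
    Set.mem_singleton_iff, or_assoc, eq_comm (a := α)]

theorem Jfam_subset_KBn (NC NR NI : Type) (n : ℕ) (nm : Fin (n + 1) ⊕ (Fin n ⊕ Fin n) → NC)
    (x : NI) (f : Fin n → Bool) : Jfam NC NR NI n nm x f ⊆ KBn NC NR NI n nm x := by
  rintro α ((rfl | ⟨i, rfl⟩) | ⟨i, rfl⟩)
  · exact Or.inr rfl
  · exact Or.inl (Or.inl (Or.inl ⟨i, rfl⟩))
  · cases h : f i
    · exact Or.inl (Or.inr ⟨i, by simp [h]⟩)
    · exact Or.inl (Or.inl (Or.inr ⟨i, by simp [h]⟩))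

theorem Jfam_entails (NC NR NI : Type) (n : ℕ) (nm : Fin (n + 1) ⊕ (Fin n ⊕ Fin n) → NC)
    (x : NI) (f : Fin n → Bool) :
    ELEntails (Jfam NC NR NI n nm x f)
      (ELAxiom.inst (ELConcept.atom (nm (Sum.inl (Fin.last n)))) x) := by
  intro I hI
  suffices h : ∀ j : Fin (n + 1), I.iI x ∈ I.cI (nm (Sum.inl j)) from h _
  intro j
  induction j using Fin.induction with
  | zero => exact hI _ (Or.inl (Or.inl rfl))
  | succ i ih =>
    have hXY := hI _ (Or.inl (Or.inr ⟨i, rfl⟩)) ih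
    have hA := hI _ (Or.inr ⟨i, rfl⟩)
    cases h : f i
    · simp only [h] at hA
      exact hA hXY.2
    · simp only [h] at hA
      exact hA hXY.1

/-- The one-element interpretation in which exactly the concept names `nm k` with `P k` hold. -/
def pointInterp (NC NR NI : Type) {κ : Type} (nm : κ → NC) (P : κ → Prop) :
    DLInterp NC NR NI where
  Dom := Unit
  dom_nonempty := ⟨()⟩
  cI A := {_u | ∃ k, nm k = A ∧ P k}
  rI _ := ∅
  iI _ := ()

theorem mem_pointInterp_cI {NC NR NI κ : Type} {nm : κ → NC} (hnm : Function.Injective nm)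
    (P : κ → Prop) (k : κ) (u : (pointInterp NC NR NI nm P).Dom) :
    u ∈ (pointInterp NC NR NI nm P).cI (nm k) ↔ P k :=
  ⟨fun ⟨_, h, hP⟩ => hnm h ▸ hP, fun hP => ⟨k, rfl, hP⟩⟩

/-- The concept names still derivable at `x` when the axiom with the given index is removed
from `J_f`, together with the unselected `X_i` or `Y_i`. -/
def derivableWithout {n : ℕ} : Option (Fin n ⊕ Fin n) → Fin (n + 1) ⊕ (Fin n ⊕ Fin n) → Prop
  | none, _ => False
  | some (Sum.inl i), Sum.inl j => j ≤ i.castSucc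
  | some (Sum.inl i), Sum.inr (Sum.inl j) => j < i
  | some (Sum.inl i), Sum.inr (Sum.inr j) => j < i
  | some (Sum.inr i), Sum.inl j => j ≤ i.castSucc
  | some (Sum.inr i), Sum.inr (Sum.inl j) => j ≤ i
  | some (Sum.inr i), Sum.inr (Sum.inr j) => j ≤ i

theorem not_derivableWithout_last {n : ℕ} (o : Option (Fin n ⊕ Fin n)) :
    ¬ derivableWithout o (Sum.inl (Fin.last n)) := by
  rcases o with _ | i | i
  · exact id
  · exact not_le.2 (Fin.castSucc_lt_last i)
  · exact not_le.2 (Fin.castSucc_lt_last i)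

theorem jfamAxiom_sat_of_ne {NC NR NI : Type} {n : ℕ}
    {nm : Fin (n + 1) ⊕ (Fin n ⊕ Fin n) → NC} (hnm : Function.Injective nm) (x : NI)
    (f : Fin n → Bool) {o p : Option (Fin n ⊕ Fin n)} (hne : p ≠ o) :
    (jfamAxiom NC NR NI n nm x f p).sat (pointInterp NC NR NI nm (derivableWithout o)) := by
  rcases p with _ | j | j
  · refine (mem_pointInterp_cI hnm _ _ _).2 ?_
    rcases o with _ | i | i
    · exact absurd rfl hne
    · exact Fin.zero_le _
    · exact Fin.zero_le _
  · intro u hu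
    have hu := (mem_pointInterp_cI hnm _ _ _).1 hu
    suffices h : derivableWithout o (Sum.inr (Sum.inl j)) ∧
        derivableWithout o (Sum.inr (Sum.inr j)) from
      ⟨(mem_pointInterp_cI hnm _ _ _).2 h.1, (mem_pointInterp_cI hnm _ _ _).2 h.2⟩
    rcases o with _ | i | i
    · exact hu.elim
    · have hji : j < i :=
        lt_of_le_of_ne (Fin.castSucc_le_castSucc_iff.1 hu) fun h => hne (h ▸ rfl)
      exact ⟨hji, hji⟩
    · have hji : j ≤ i := Fin.castSucc_le_castSucc_iff.1 hu
      exact ⟨hji, hji⟩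
  · have key : ∀ k : Fin n ⊕ Fin n, k = Sum.inl j ∨ k = Sum.inr j →
        derivableWithout o (Sum.inr k) → derivableWithout o (Sum.inl j.succ) := by
      intro k hk hu
      rcases o with _ | i | i
      · exact hu
      · have hji : j < i := by rcases hk with rfl | rfl <;> exact hu
        exact Fin.succ_le_castSucc_iff.2 hji
      · have hji : j ≤ i := by rcases hk with rfl | rfl <;> exact hu
        exact Fin.succ_le_castSucc_iff.2 (lt_of_le_of_ne hji fun h => hne (h ▸ rfl))
    simp only [jfamAxiom]
    split_ifs
    · exact fun u hu => (mem_pointInterp_cI hnm _ _ _).2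
        (key _ (Or.inl rfl) ((mem_pointInterp_cI hnm _ _ _).1 hu))
    · exact fun u hu => (mem_pointInterp_cI hnm _ _ _).2
        (key _ (Or.inr rfl) ((mem_pointInterp_cI hnm _ _ _).1 hu))

theorem not_entails_of_jfamAxiom_notMem {NC NR NI : Type} {n : ℕ}
    {nm : Fin (n + 1) ⊕ (Fin n ⊕ Fin n) → NC} (hnm : Function.Injective nm) (x : NI)
    (f : Fin n → Bool) (o : Option (Fin n ⊕ Fin n)) {S : Set (ELAxiom NC NR NI)}
    (hS : ∀ α ∈ S, ∃ p, p ≠ o ∧ jfamAxiom NC NR NI n nm x f p = α) :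
    ¬ ELEntails S (ELAxiom.inst (ELConcept.atom (nm (Sum.inl (Fin.last n)))) x) := by
  intro h
  refine not_derivableWithout_last o ((mem_pointInterp_cI (NR := NR) (NI := NI) hnm _ _ _).1
    (h (pointInterp NC NR NI nm (derivableWithout o)) ?_))
  intro α hα
  obtain ⟨p, hp, rfl⟩ := hS α hα
  exact jfamAxiom_sat_of_ne hnm x f hp

theorem jfamAxiom_injective {NC NR NI : Type} {n : ℕ}
    {nm : Fin (n + 1) ⊕ (Fin n ⊕ Fin n) → NC} (hnm : Function.Injective nm) (x : NI)
    (f : Fin n → Bool) : Function.Injective (jfamAxiom NC NR NI n nm x f) := by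
  intro o p hop
  by_contra hne
  refine not_entails_of_jfamAxiom_notMem hnm x f o ?_ (Jfam_entails NC NR NI n nm x f)
  rw [← range_jfamAxiom]
  rintro _ ⟨q, rfl⟩
  by_cases hq : q = o
  · exact ⟨p, fun h => hne h.symm, by rw [hq, hop]⟩
  · exact ⟨q, hq, rfl⟩

/-- `K_n ⊨ A_n(x)`, and for every `f : {1,…,n} → {X,Y}`, the set `J_f` is a
justification for `A_n(x)` in `K_n` of cardinality `2n + 1`. -/
theorem family_all_Jf_are_justifications (NC NR NI : Type) (n : ℕ) (hn : 1 ≤ n)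
    (nm : Fin (n + 1) ⊕ (Fin n ⊕ Fin n) → NC) (hnm : Function.Injective nm) (x : NI) :
    ELEntails (KBn NC NR NI n nm x)
      (ELAxiom.inst (ELConcept.atom (nm (Sum.inl (Fin.last n)))) x) ∧
    ∀ f : Fin n → Bool,
      ELJustification (KBn NC NR NI n nm x)
        (ELAxiom.inst (ELConcept.atom (nm (Sum.inl (Fin.last n)))) x)
        (Jfam NC NR NI n nm x f) ∧
      (Jfam NC NR NI n nm x f).ncard = 2 * n + 1 := by
  refine ⟨fun I hI => Jfam_entails NC NR NI n nm x (fun _ => true) I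
    fun α hα => hI α (Jfam_subset_KBn NC NR NI n nm x _ hα), fun f =>
    ⟨⟨Jfam_subset_KBn NC NR NI n nm x f, Jfam_entails NC NR NI n nm x f, ?_⟩, ?_⟩⟩
  · intro J' hJ'
    obtain ⟨α, hα, hαJ'⟩ := Set.exists_of_ssubset hJ'
    rw [← range_jfamAxiom] at hα hJ'
    obtain ⟨o, rfl⟩ := hα
    refine not_entails_of_jfamAxiom_notMem hnm x f o fun β hβ => ?_
    obtain ⟨p, rfl⟩ := hJ'.1 hβ
    exact ⟨p, fun h => hαJ' (h ▸ hβ), rfl⟩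
  · rw [← range_jfamAxiom, ← Set.image_univ,
      Set.ncard_image_of_injective _ (jfamAxiom_injective hnm x f), Set.ncard_univ,
      Nat.card_eq_fintype_card, Fintype.card_option, Fintype.card_sum, Fintype.card_fin, two_mul]
end
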